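/- For every finite region R and every n ≥ 2, the number of n-ribbon tilings of R satisfies T_n(R) ≤ n^{A(R)/n}, where A(R) is the area of R; equivalently, the per-tile entropy Ent_n(R) = log₂(T_n(R))/(A(R)/n) is at most log₂ n. -/

import Mathlib

attribute [local instance] Classical.propDecidable

/-- The level of the unit square `[x,x+1] × [y,y+1]`, indexed by `(x,y)`. -/
def level (s : ℤ × ℤ) : ℤ := s.1 + s.2

/-- An `n`-ribbon: a connected sequence of `n` unit squares, each after the first
directly above or to the right of its predecessor. -/
def IsRibbon (n : ℕ) (T : Finset (ℤ × ℤ)) : Prop :=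
  ∃ f : ℕ → ℤ × ℤ,
    (∀ i, i + 1 < n → f (i + 1) = f i + (1, 0) ∨ f (i + 1) = f i + (0, 1)) ∧
    T = (Finset.range n).image f

/-- An `n`-ribbon tiling of a region `R`: a partition of the squares of `R` into `n`-ribbons. -/
def IsTiling (n : ℕ) (R : Finset (ℤ × ℤ)) (P : Finset (Finset (ℤ × ℤ))) : Prop :=
  (∀ T ∈ P, IsRibbon n T) ∧
  (P : Set (Finset (ℤ × ℤ))).PairwiseDisjoint id ∧
  P.biUnion id = R

/-- The number of `n`-ribbon tilings of a region `R`. -/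
noncomputable def TilingCount (n : ℕ) (R : Finset (ℤ × ℤ)) : ℕ :=
  Set.ncard {P | IsTiling n R P}

/-- `s` is the root square of the tile `T`: its square of smallest level. -/
def IsRoot (T : Finset (ℤ × ℤ)) (s : ℤ × ℤ) : Prop :=
  s ∈ T ∧ ∀ t ∈ T, level s ≤ level t

/-- The set of root squares of the tiles of a tiling `P`. -/
def rootSet (P : Finset (Finset (ℤ × ℤ))) : Set (ℤ × ℤ) :=
  {s | ∃ T ∈ P, IsRoot T s}

/-- The number `τ_l` of tiles of `P` whose root square has level `l`. -/
noncomputable def tilesAtLevel (P : Finset (Finset (ℤ × ℤ))) (l : ℤ) : ℕ :=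
  (P.filter (fun T => ∃ s, IsRoot T s ∧ level s = l)).card

/-- The left-of relation on unit squares. -/
def LeftOf (s t : ℤ × ℤ) : Prop :=
  (level s = level t ∧ s.1 < t.1) ∨ (|level s - level t| = 1 ∧ s.1 ≤ t.1 ∧ t.2 ≤ s.2)

/-- The maximal number of `n`-ribbon tilings over all regions of area `a * n`. -/
noncomputable def maxT (n a : ℕ) : ℕ :=
  sSup {t : ℕ | ∃ R : Finset (ℤ × ℤ), R.card = a * n ∧ TilingCount n R = t}

/-- `D` can be matched with `U \ X` by moving every point of `D` by `0` or `1`. -/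
def IsShiftMatched (D U X : Finset ℤ) : Prop :=
  X ⊆ U ∧ ∃ μ : ℤ → ℤ, (∀ u ∈ D, μ u = u ∨ μ u = u + 1) ∧ Set.InjOn μ D ∧ D.image μ = U \ X

lemma IsShiftMatched.card_add_card {D U X : Finset ℤ} (h : IsShiftMatched D U X) :
    X.card + D.card = U.card := by
  obtain ⟨hX, μ, -, hinj, him⟩ := h
  rw [← Finset.card_image_of_injOn hinj, him, add_comm, Finset.card_sdiff_add_card_eq_card hX]

/-- The rank of an element of `X` among `X` can be read off from `D` and `U` alone. -/
lemma IsShiftMatched.card_filter_le {D U X : Finset ℤ} (h : IsShiftMatched D U X) {t : ℤ}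
    (ht : t ∈ X) :
    (X.filter (· ≤ t)).card + (D.filter (· < t)).card = (U.filter (· ≤ t)).card := by
  obtain ⟨hX, μ, hμ, hinj, him⟩ := h
  have key : (D.filter (· < t)).image μ = U.filter (· ≤ t) \ X.filter (· ≤ t) := by
    ext y
    have hy : y ∈ D.image μ ↔ y ∈ U \ X := by rw [him]
    simp only [Finset.mem_image, Finset.mem_sdiff, Finset.mem_filter] at hy ⊢
    constructor
    · rintro ⟨u, ⟨hu, hut⟩, rfl⟩
      have h1 := hy.1 ⟨u, hu, rfl⟩
      have h2 := hμ u hu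
      exact ⟨⟨h1.1, by omega⟩, fun h3 => h1.2 h3.1⟩
    · rintro ⟨⟨hyU, hyt⟩, hyX⟩
      have hyX' : y ∉ X := fun h3 => hyX ⟨h3, hyt⟩
      obtain ⟨u, hu, rfl⟩ := hy.2 ⟨hyU, hyX'⟩
      have h2 := hμ u hu
      have h3 : μ u ≠ t := fun h4 => hyX' (h4 ▸ ht)
      exact ⟨u, ⟨hu, by omega⟩, rfl⟩
  have hinj' : Set.InjOn μ (D.filter (· < t)) :=
    hinj.mono (Finset.coe_subset.2 (Finset.filter_subset _ _))
  rw [← Finset.card_image_of_injOn hinj', key, add_comm,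
    Finset.card_sdiff_add_card_eq_card (Finset.filter_subset_filter _ hX)]

lemma prod_le_pow_mul_exp {ι : Type*} [Fintype ι] (b : ι → ℕ) {n : ℕ} (hn : 0 < n) {S : ℕ}
    (hb : ∑ i, b i ≤ S) :
    ((∏ i, b i : ℕ) : ℝ) ≤
      (n : ℝ) ^ Fintype.card ι * Real.exp ((S : ℝ) / n - Fintype.card ι) := by
  have hn' : (0 : ℝ) < n := by exact_mod_cast hn
  calc ((∏ i, b i : ℕ) : ℝ) = ∏ i, (b i : ℝ) := by push_cast; rfl
    _ ≤ ∏ i, ((n : ℝ) * Real.exp ((b i : ℝ) / n - 1)) := by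
        refine Finset.prod_le_prod (fun i _ => by positivity) fun i _ => ?_
        have h := Real.add_one_le_exp ((b i : ℝ) / n - 1)
        calc (b i : ℝ) = n * ((b i : ℝ) / n - 1 + 1) := by field_simp; ring
          _ ≤ _ := by gcongr
    _ = (n : ℝ) ^ Fintype.card ι * Real.exp ((∑ i, (b i : ℝ)) / n - Fintype.card ι) := by
        rw [Finset.prod_mul_distrib, ← Real.exp_sum, Finset.sum_sub_distrib, Finset.sum_div]
        simp
    _ ≤ _ := by
        gcongr
        exact_mod_cast hb

lemma card_le_of_isShiftMatched {D U : Finset ℤ} {𝒳 : Finset (Finset ℤ)} {n τ : ℕ} (hn : 0 < n)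
    (h : ∀ X ∈ 𝒳, IsShiftMatched D U X) (hτ : ∀ X ∈ 𝒳, X.card = τ) :
    (𝒳.card : ℝ) ≤ (n : ℝ) ^ τ * Real.exp ((U.card : ℝ) / n - τ) := by
  let B : Fin τ → Finset ℤ := fun i =>
    U.filter fun t => (i : ℕ) + 1 + (D.filter (· < t)).card = (U.filter (· ≤ t)).card
  have hsub : 𝒳 ⊆ (Fintype.piFinset B).image fun f => Finset.univ.image f := by
    intro X hX
    refine Finset.mem_image.2 ⟨X.orderEmbOfFin (hτ X hX), ?_, ?_⟩
    · refine Fintype.mem_piFinset.2 fun i => Finset.mem_filter.2 ⟨?_, ?_⟩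
      · exact (h X hX).1 (Finset.orderEmbOfFin_mem _ _ _)
      · rw [← (h X hX).card_filter_le (Finset.orderEmbOfFin_mem _ (hτ X hX) i)]
        congr 1
        have : X.filter (· ≤ X.orderEmbOfFin (hτ X hX) i) =
            (Finset.Iic i).image (X.orderEmbOfFin (hτ X hX)) := by
          ext y
          simp only [Finset.mem_filter, Finset.mem_image, Finset.mem_Iic]
          constructor
          · rintro ⟨hy, hle⟩
            rw [← Finset.mem_coe, ← Finset.range_orderEmbOfFin X (hτ X hX)] at hy
            obtain ⟨j, rfl⟩ := hy
            exact ⟨j, by simpa using hle, rfl⟩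
          · rintro ⟨j, hj, rfl⟩
            exact ⟨Finset.orderEmbOfFin_mem _ _ _, by simpa using hj⟩
        rw [this, Finset.card_image_of_injective _ (X.orderEmbOfFin (hτ X hX)).injective, Fin.card_Iic]
    · exact Finset.image_orderEmbOfFin_univ X (hτ X hX)
  have hsum : ∑ i, (B i).card ≤ U.card := by
    rw [← Finset.card_biUnion]
    · exact Finset.card_le_card (Finset.biUnion_subset.2 fun i _ => Finset.filter_subset _ _)
    · intro i _ j _ hij
      refine Finset.disjoint_left.2 fun t hi hj => hij ?_
      have hi := (Finset.mem_filter.1 hi).2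
      have hj := (Finset.mem_filter.1 hj).2
      exact Fin.ext (by omega)
  have hcard : 𝒳.card ≤ ∏ i, (B i).card :=
    (Finset.card_le_card hsub).trans (Finset.card_image_le.trans (Fintype.card_piFinset B).le)
  have := prod_le_pow_mul_exp (fun i => (B i).card) hn hsum
  rw [Fintype.card_fin] at this
  exact (Nat.cast_le.2 hcard).trans this

lemma eqOn_of_image_eq {D : Finset ℤ} {μ ν : ℤ → ℤ}
    (hμ : ∀ u ∈ D, μ u = u ∨ μ u = u + 1) (hν : ∀ u ∈ D, ν u = u ∨ ν u = u + 1)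
    (hμi : Set.InjOn μ D) (hνi : Set.InjOn ν D) (h : D.image μ = D.image ν) :
    ∀ u ∈ D, μ u = ν u := by
  have mono : ∀ κ : ℤ → ℤ, (∀ u ∈ D, κ u = u ∨ κ u = u + 1) → Set.InjOn κ D →
      StrictMono fun u : D => κ u := by
    intro κ hκ hi u v huv
    have h1 := hκ u u.2
    have h2 := hκ v v.2
    have h3 : (u : ℤ) < v := huv
    have h4 : κ u ≠ κ v := fun h => h3.ne (hi u.2 v.2 h)
    show κ u < κ v
    omega
  have := ((mono μ hμ hμi).range_inj (mono ν hν hνi)).1 (by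
    ext y
    simpa using congrArg (y ∈ ·) h)
  exact fun u hu => congrFun this ⟨u, hu⟩

/-- `ρ` sends every square of `R` to the root square of its tile in some `n`-ribbon tiling
of `R`, and every other square to `0`. -/
structure IsRootLabeling (n : ℕ) (R : Finset (ℤ × ℤ)) (ρ : ℤ × ℤ → ℤ × ℤ) : Prop where
  eq_zero : ∀ s ∉ R, ρ s = 0
  level_le : ∀ s ∈ R, level (ρ s) ≤ level s
  lt_level_add : ∀ s ∈ R, level s < level (ρ s) + n
  exists_next : ∀ s ∈ R, level s + 1 < level (ρ s) + n →
    ∃ t ∈ R, (t = s + (1, 0) ∨ t = s + (0, 1)) ∧ ρ t = ρ s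
  exists_prev : ∀ s ∈ R, ρ s ≠ s → ∃ u ∈ R, (s = u + (1, 0) ∨ s = u + (0, 1)) ∧ ρ u = ρ s
  eq_of_level_eq : ∀ s ∈ R, ∀ t ∈ R, level s = level t → ρ s = ρ t → s = t
  card_eq : R.card = n * (R.filter fun s => ρ s = s).card

/-- The first coordinates of the squares of `R` of level `m`. -/
noncomputable def slice (R : Finset (ℤ × ℤ)) (m : ℤ) : Finset ℤ :=
  (R.filter fun s => level s = m).image Prod.fst

lemma mem_slice {R : Finset (ℤ × ℤ)} {m x : ℤ} : x ∈ slice R m ↔ (x, m - x) ∈ R := by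
  simp only [slice, Finset.mem_image, Finset.mem_filter]
  constructor
  · rintro ⟨⟨a, b⟩, ⟨hR, rfl⟩, rfl⟩
    simpa [level] using hR
  · exact fun h => ⟨_, ⟨h, by simp [level]⟩, rfl⟩

lemma card_slice (R : Finset (ℤ × ℤ)) (m : ℤ) :
    (slice R m).card = (R.filter fun s => level s = m).card := by
  refine Finset.card_image_of_injOn ?_
  rintro ⟨a, b⟩ h1 ⟨c, d⟩ h2 (rfl : a = c)
  have e1 : a + b = m := (Finset.mem_filter.1 h1).2
  have e2 : a + d = m := (Finset.mem_filter.1 h2).2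
  rw [show b = d by omega]

/-- The first coordinates of the squares of level `m - 1` whose tile continues to level `m`. -/
noncomputable def continuing (n : ℕ) (R : Finset (ℤ × ℤ)) (ρ : ℤ × ℤ → ℤ × ℤ) (m : ℤ) :
    Finset ℤ :=
  slice (R.filter fun s => m < level (ρ s) + n) (m - 1)

/-- The first coordinates of the root squares of level `m`. -/
noncomputable def rootSlice (R : Finset (ℤ × ℤ)) (ρ : ℤ × ℤ → ℤ × ℤ) (m : ℤ) : Finset ℤ :=
  slice (R.filter fun s => ρ s = s) m

namespace IsRootLabeling

variable {n : ℕ} {R : Finset (ℤ × ℤ)} {ρ ρ' : ℤ × ℤ → ℤ × ℤ}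

lemma exists_shift (h : IsRootLabeling n R ρ) (m : ℤ) :
    ∃ μ : ℤ → ℤ, (∀ u ∈ continuing n R ρ m, μ u = u ∨ μ u = u + 1) ∧
      Set.InjOn μ (continuing n R ρ m) ∧
      (continuing n R ρ m).image μ = slice R m \ rootSlice R ρ m ∧
      ∀ u ∈ continuing n R ρ m, ρ (μ u, m - μ u) = ρ (u, m - 1 - u) := by
  have hex : ∀ u, ∃ v, u ∈ continuing n R ρ m →
      (v = u ∨ v = u + 1) ∧ (v, m - v) ∈ R ∧ ρ (v, m - v) = ρ (u, m - 1 - u) := by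
    intro u
    by_cases hu : u ∈ continuing n R ρ m
    · have hu' := hu
      rw [continuing, mem_slice, Finset.mem_filter] at hu'
      obtain ⟨t, ht, htu, hρ⟩ := h.exists_next _ hu'.1 (by
        have : level (u, m - 1 - u) = m - 1 := by simp [level]
        omega)
      have htm : t = (t.1, m - t.1) := by
        rcases htu with rfl | rfl <;> ext <;> simp <;> ring
      refine ⟨t.1, fun _ => ⟨?_, htm ▸ ht, htm ▸ hρ⟩⟩
      rcases htu with rfl | rfl <;> simp
    · exact ⟨u, fun h => absurd h hu⟩
  choose μ hμ using hex
  have hmem : ∀ u, u ∈ continuing n R ρ m ↔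
      (u, m - 1 - u) ∈ R ∧ m < level (ρ (u, m - 1 - u)) + n := fun u => by
    rw [continuing, mem_slice, Finset.mem_filter]
  refine ⟨μ, fun u hu => (hμ u hu).1, ?_, ?_, fun u hu => (hμ u hu).2.2⟩
  · intro u hu v hv huv
    have h1 := (hμ u hu).2.2
    have h2 := (hμ v hv).2.2
    rw [huv] at h1
    have := h.eq_of_level_eq _ ((hmem u).1 hu).1 _ ((hmem v).1 hv).1 (by simp [level])
      (h1.symm.trans h2)
    exact congrArg Prod.fst this
  · ext y
    rw [Finset.mem_image, Finset.mem_sdiff, mem_slice, rootSlice, mem_slice, Finset.mem_filter]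
    constructor
    · rintro ⟨u, hu, rfl⟩
      obtain ⟨-, hR, hρ⟩ := hμ u hu
      refine ⟨hR, fun hroot => ?_⟩
      have h1 := h.level_le _ ((hmem u).1 hu).1
      rw [← hρ, hroot.2] at h1
      simp only [level] at h1
      omega
    · rintro ⟨hR, hroot⟩
      obtain ⟨u, hu, huy, hρ⟩ := h.exists_prev _ hR fun h' => hroot ⟨hR, h'⟩
      have hum : u = (u.1, m - 1 - u.1) := by
        refine Prod.ext rfl ?_
        show u.2 = m - 1 - u.1
        rcases huy with huy | huy <;> simp only [Prod.ext_iff, Prod.fst_add, Prod.snd_add] at huy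
          <;> omega
      have hcont : u.1 ∈ continuing n R ρ m := by
        rw [hmem, ← hum, hρ]
        have := h.lt_level_add _ hR
        simp only [level] at this ⊢
        exact ⟨hu, by omega⟩
      refine ⟨u.1, hcont, ?_⟩
      obtain ⟨-, hR', hρ'⟩ := hμ _ hcont
      rw [← hum, hρ] at hρ'
      exact congrArg Prod.fst (h.eq_of_level_eq _ hR' _ hR (by simp [level]) hρ')

lemma isShiftMatched (h : IsRootLabeling n R ρ) (m : ℤ) :
    IsShiftMatched (continuing n R ρ m) (slice R m) (rootSlice R ρ m) := by
  obtain ⟨μ, h1, h2, h3, -⟩ := h.exists_shift m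
  refine ⟨fun x hx => ?_, μ, h1, h2, h3⟩
  rw [rootSlice, mem_slice, Finset.mem_filter] at hx
  exact mem_slice.2 hx.1

lemma continuing_congr {m : ℤ} (hlt : ∀ s ∈ R, level s < m → ρ s = ρ' s) :
    continuing n R ρ m = continuing n R ρ' m := by
  ext u
  simp only [continuing, mem_slice, Finset.mem_filter]
  refine and_congr_right fun hu => ?_
  rw [hlt _ hu (by simp [level])]

lemma eq_of_rootSlice_eq (h : IsRootLabeling n R ρ) (h' : IsRootLabeling n R ρ') {m : ℤ}
    (hlt : ∀ s ∈ R, level s < m → ρ s = ρ' s) (hroot : rootSlice R ρ m = rootSlice R ρ' m) :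
    ∀ s ∈ R, level s < m + 1 → ρ s = ρ' s := by
  intro s hs hsm
  rcases (Int.lt_add_one_iff.1 hsm).lt_or_eq with hsm | hsm
  · exact hlt s hs hsm
  obtain ⟨μ, h1, h2, h3, h4⟩ := h.exists_shift m
  obtain ⟨ν, k1, k2, k3, k4⟩ := h'.exists_shift m
  rw [← continuing_congr hlt] at k1 k2 k3 k4
  have hμν := eqOn_of_image_eq h1 k1 h2 k2 (by rw [h3, k3, hroot])
  have hsm' : s = (s.1, m - s.1) := by
    ext <;> simp [← hsm, level]
  have hsl : s.1 ∈ slice R m := mem_slice.2 (hsm' ▸ hs)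
  by_cases hr : s.1 ∈ rootSlice R ρ m
  · have hr' := hroot ▸ hr
    simp only [rootSlice, mem_slice, Finset.mem_filter, ← hsm'] at hr hr'
    rw [hr.2, hr'.2]
  · have : s.1 ∈ (continuing n R ρ m).image μ := h3 ▸ Finset.mem_sdiff.2 ⟨hsl, hr⟩
    obtain ⟨u, hu, hus⟩ := Finset.mem_image.1 this
    have e1 := h4 u hu
    have e2 := k4 u hu
    rw [← hμν u hu] at e2
    rw [hus, ← hsm'] at e1 e2
    rw [e1, e2]
    rw [continuing, mem_slice, Finset.mem_filter] at hu
    exact hlt _ hu.1 (by simp [level])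

end IsRootLabeling

lemma card_filter_le_level (S : Finset (ℤ × ℤ)) (m : ℤ) :
    (S.filter fun s => m ≤ level s).card =
      (slice S m).card + (S.filter fun s => m + 1 ≤ level s).card := by
  rw [card_slice, ← Finset.card_union_of_disjoint]
  · congr 1
    ext s
    simp only [Finset.mem_union, Finset.mem_filter, ← and_or_left]
    exact and_congr_right fun _ => by omega
  · refine Finset.disjoint_filter.2 fun s _ h1 h2 => by omega

lemma IsRootLabeling.card_roots_eq {n : ℕ} (hn : 0 < n) {R : Finset (ℤ × ℤ)}
    {ρ ρ' : ℤ × ℤ → ℤ × ℤ} (h : IsRootLabeling n R ρ) (h' : IsRootLabeling n R ρ') {m : ℤ}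
    (hlt : ∀ s ∈ R, level s < m → ρ s = ρ' s) :
    ((R.filter fun s => ρ s = s).filter fun s => m ≤ level s).card =
      ((R.filter fun s => ρ' s = s).filter fun s => m ≤ level s).card := by
  have h1 : (R.filter fun s => ρ s = s).card = (R.filter fun s => ρ' s = s).card :=
    Nat.eq_of_mul_eq_mul_left hn (h.card_eq.symm.trans h'.card_eq)
  have h2 : (R.filter fun s => ρ s = s).filter (fun s => ¬ m ≤ level s) =
      (R.filter fun s => ρ' s = s).filter fun s => ¬ m ≤ level s := by
    ext s
    simp only [Finset.mem_filter, and_assoc]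
    refine and_congr_right fun hs => and_congr_left fun hm => ?_
    rw [hlt s hs (not_le.1 hm)]
  have h3 := Finset.card_filter_add_card_filter_not (s := R.filter fun s => ρ s = s)
    fun s => m ≤ level s
  have h4 := Finset.card_filter_add_card_filter_not (s := R.filter fun s => ρ' s = s)
    fun s => m ≤ level s
  rw [h2] at h3
  omega

lemma card_rootLabelings_le_of_agree {n : ℕ} (hn : 0 < n) {R : Finset (ℤ × ℤ)} (K : ℕ) :
    ∀ (m : ℤ) (Ω : Finset (ℤ × ℤ → ℤ × ℤ)), (∀ ρ ∈ Ω, IsRootLabeling n R ρ) →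
      (∀ ρ ∈ Ω, ∀ ρ' ∈ Ω, ∀ s ∈ R, level s < m → ρ s = ρ' s) →
      (∀ s ∈ R, level s < m + K) → ∀ ρ ∈ Ω,
      (Ω.card : ℝ) ≤
        (n : ℝ) ^ ((R.filter fun s => ρ s = s).filter fun s => m ≤ level s).card *
        Real.exp (((R.filter fun s => m ≤ level s).card : ℝ) / n -
          ((R.filter fun s => ρ s = s).filter fun s => m ≤ level s).card) := by
  induction K with
  | zero =>
    intro m Ω hΩ hagree hR ρ hρ
    have hR' : ∀ s ∈ R, level s < m := by simpa using hR
    have h1 : Ω.card ≤ 1 := by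
      refine Finset.card_le_one.2 fun ρ₁ h₁ ρ₂ h₂ => funext fun s => ?_
      by_cases hs : s ∈ R
      · exact hagree _ h₁ _ h₂ s hs (hR' s hs)
      · rw [(hΩ _ h₁).eq_zero s hs, (hΩ _ h₂).eq_zero s hs]
    have h2 : (R.filter fun s => m ≤ level s) = ∅ :=
      Finset.filter_eq_empty_iff.2 fun s hs => not_le.2 (hR' s hs)
    have h3 : ((R.filter fun s => ρ s = s).filter fun s => m ≤ level s) = ∅ :=
      Finset.filter_eq_empty_iff.2 fun s hs => not_le.2 (hR' s (Finset.mem_filter.1 hs).1)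
    rw [h2, h3]
    simpa using h1
  | succ K ih =>
    intro m Ω hΩ hagree hR ρ hρ
    have hτ : ∀ ρ' ∈ Ω, (rootSlice R ρ' m).card = (rootSlice R ρ m).card := by
      intro ρ' hρ'
      have h1 := ((hΩ _ hρ').isShiftMatched m).card_add_card
      have h2 := ((hΩ _ hρ).isShiftMatched m).card_add_card
      rw [IsRootLabeling.continuing_congr (hagree ρ' hρ' ρ hρ)] at h1
      omega
    have himage := card_le_of_isShiftMatched (D := continuing n R ρ m) (U := slice R m)
      (𝒳 := Ω.image fun ρ' => rootSlice R ρ' m) (τ := (rootSlice R ρ m).card) hn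
      (by
        refine Finset.forall_mem_image.2 fun ρ' hρ' => ?_
        rw [← IsRootLabeling.continuing_congr (hagree ρ' hρ' ρ hρ)]
        exact (hΩ _ hρ').isShiftMatched m)
      (Finset.forall_mem_image.2 hτ)
    have hfiber : ∀ X ∈ Ω.image fun ρ' => rootSlice R ρ' m,
        ((Ω.filter fun ρ' => rootSlice R ρ' m = X).card : ℝ) ≤
        (n : ℝ) ^ ((R.filter fun s => ρ s = s).filter fun s => m + 1 ≤ level s).card *
        Real.exp (((R.filter fun s => m + 1 ≤ level s).card : ℝ) / n -
          ((R.filter fun s => ρ s = s).filter fun s => m + 1 ≤ level s).card) := by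
      refine Finset.forall_mem_image.2 fun ρ' hρ' => ?_
      have h1 := ih (m + 1) (Ω.filter fun ρ₁ => rootSlice R ρ₁ m = rootSlice R ρ' m)
        (fun ρ₁ h₁ => hΩ _ (Finset.mem_filter.1 h₁).1)
        (fun ρ₁ h₁ ρ₂ h₂ => by
          rw [Finset.mem_filter] at h₁ h₂
          exact (hΩ _ h₁.1).eq_of_rootSlice_eq (hΩ _ h₂.1) (hagree _ h₁.1 _ h₂.1)
            (h₁.2.trans h₂.2.symm))
        (fun s hs => by have := hR s hs; push_cast at this; omega)
        ρ' (Finset.mem_filter.2 ⟨hρ', rfl⟩)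
      have h2 := (hΩ _ hρ').card_roots_eq hn (hΩ _ hρ) (hagree _ hρ' _ hρ)
      have h3 := hτ ρ' hρ'
      rw [card_filter_le_level, card_filter_le_level (R.filter fun s => ρ s = s)] at h2
      unfold rootSlice at h3
      have h4 := Nat.add_left_cancel (h3 ▸ h2)
      rwa [h4] at h1
    calc (Ω.card : ℝ) = ∑ X ∈ Ω.image fun ρ' => rootSlice R ρ' m,
          ((Ω.filter fun ρ' => rootSlice R ρ' m = X).card : ℝ) := by
          exact_mod_cast Finset.card_eq_sum_card_image (fun ρ' => rootSlice R ρ' m) Ω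
      _ ≤ _ := Finset.sum_le_card_nsmul _ _ _ hfiber
      _ ≤ _ := (nsmul_eq_mul _ _).trans_le (mul_le_mul_of_nonneg_right himage (by positivity))
      _ = _ := by
        rw [card_filter_le_level R m, card_filter_le_level (R.filter fun s => ρ s = s) m,
          mul_mul_mul_comm, ← pow_add, ← Real.exp_add]
        unfold rootSlice
        push_cast
        congr 2
        ring

lemma card_rootLabelings_le {n : ℕ} (hn : 0 < n) {R : Finset (ℤ × ℤ)}
    (Ω : Finset (ℤ × ℤ → ℤ × ℤ)) (hΩ : ∀ ρ ∈ Ω, IsRootLabeling n R ρ) :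
    Ω.card ≤ n ^ (R.card / n) := by
  rcases Ω.eq_empty_or_nonempty with rfl | ⟨ρ, hρ⟩
  · simp
  obtain ⟨a, ha⟩ := (R.image level).bddBelow
  obtain ⟨b, hb⟩ := (R.image level).bddAbove
  have hlow : ∀ s ∈ R, a ≤ level s := fun s hs => ha (Finset.mem_image_of_mem _ hs)
  have hup : ∀ s ∈ R, level s ≤ b := fun s hs => hb (Finset.mem_image_of_mem _ hs)
  have h1 := card_rootLabelings_le_of_agree hn (b + 1 - a).toNat a Ω hΩ
    (fun _ _ _ _ s hs hlt => absurd (hlow s hs) (not_le.2 hlt))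
    (fun s hs => by have := hup s hs; omega) ρ hρ
  rw [Finset.filter_true_of_mem hlow,
    Finset.filter_true_of_mem fun s hs => hlow s (Finset.mem_filter.1 hs).1] at h1
  have h2 := (hΩ ρ hρ).card_eq
  have hn' : (n : ℝ) ≠ 0 := by exact_mod_cast hn.ne'
  have h3 : (R.card : ℝ) / n = (R.filter fun s => ρ s = s).card := by
    rw [h2]; push_cast; field_simp
  rw [h3, sub_self, Real.exp_zero, mul_one] at h1
  rw [h2, Nat.mul_div_cancel_left _ hn]
  exact_mod_cast h1

lemma IsTiling.exists_isRootLabeling {n : ℕ} (hn : 0 < n) {R : Finset (ℤ × ℤ)}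
    {P : Finset (Finset (ℤ × ℤ))} (hP : IsTiling n R P) :
    ∃ ρ, IsRootLabeling n R ρ ∧ P = R.image fun s => R.filter fun t => ρ t = ρ s := by
  obtain ⟨hrib, hdisj, hcover⟩ := hP
  choose! f hf hT using hrib
  have hlevel : ∀ T ∈ P, ∀ i < n, level (f T i) = level (f T 0) + i := by
    intro T hTP i
    induction i with
    | zero => simp
    | succ i ih =>
      intro hi
      have := ih (by omega)
      rcases hf T hTP i hi with h | h <;> rw [h] <;> simp only [level, Prod.fst_add,
        Prod.snd_add] at this ⊢ <;> push_cast <;> omega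
  have hfT : ∀ T ∈ P, ∀ i < n, f T i ∈ T := fun T hTP i hi => by
    have := Finset.mem_image_of_mem (f T) (Finset.mem_range.2 hi)
    rwa [← hT T hTP] at this
  have huniq : ∀ T ∈ P, ∀ T' ∈ P, ∀ s ∈ T, s ∈ T' → T = T' := fun T hTP T' hTP' s hs hs' =>
    hdisj.elim_finset hTP hTP' s hs hs'
  have hex : ∀ s, ∃ T, s ∈ R → T ∈ P ∧ s ∈ T := fun s => by
    by_cases hs : s ∈ R
    · rw [← hcover, Finset.mem_biUnion] at hs
      obtain ⟨T, h1, h2⟩ := hs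
      exact ⟨T, fun _ => ⟨h1, h2⟩⟩
    · exact ⟨∅, fun h => absurd h hs⟩
  choose tile htile using hex
  have hTR : ∀ T ∈ P, ∀ s ∈ T, s ∈ R := fun T hTP s hs => by
    rw [← hcover]
    exact Finset.mem_biUnion.2 ⟨T, hTP, hs⟩
  let ρ : ℤ × ℤ → ℤ × ℤ := fun s => if s ∈ R then f (tile s) 0 else 0
  have hρ : ∀ T ∈ P, ∀ s ∈ T, ρ s = f T 0 := fun T hTP s hs => by
    have h1 := hTR T hTP s hs
    have h2 := htile s h1
    simp only [ρ, if_pos h1, huniq _ h2.1 _ hTP s h2.2 hs]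
  have hcases : ∀ s ∈ R, ∃ T ∈ P, ∃ i < n, s = f T i := fun s hs => by
    obtain ⟨h1, h2⟩ := htile s hs
    have h3 := h2
    rw [hT _ h1] at h3
    obtain ⟨i, hi, h4⟩ := Finset.mem_image.1 h3
    exact ⟨_, h1, i, Finset.mem_range.1 hi, h4.symm⟩
  have hρf : ∀ T ∈ P, ∀ i < n, ρ (f T i) = f T 0 := fun T hTP i hi =>
    hρ T hTP _ (hfT T hTP i hi)
  have hroot : ∀ T ∈ P, ∀ T' ∈ P, f T 0 = f T' 0 → T = T' := fun T hTP T' hTP' h =>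
    huniq T hTP T' hTP' _ (hfT T hTP 0 hn) (h ▸ hfT T' hTP' 0 hn)
  have hinj : ∀ T ∈ P, ∀ i < n, ∀ j < n, f T i = f T j → i = j := fun T hTP i hi j hj h => by
    have h1 := hlevel T hTP i hi
    have h2 := hlevel T hTP j hj
    rw [h] at h1
    omega
  refine ⟨ρ, ⟨fun s hs => if_neg hs, ?_, ?_, ?_, ?_, ?_, ?_⟩, ?_⟩
  · intro s hs
    obtain ⟨T, hTP, i, hi, rfl⟩ := hcases s hs
    rw [hρf T hTP i hi, hlevel T hTP i hi]
    omega
  · intro s hs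
    obtain ⟨T, hTP, i, hi, rfl⟩ := hcases s hs
    rw [hρf T hTP i hi, hlevel T hTP i hi]
    omega
  · intro s hs hlt
    obtain ⟨T, hTP, i, hi, rfl⟩ := hcases s hs
    rw [hρf T hTP i hi, hlevel T hTP i hi] at hlt
    have hi' : i + 1 < n := by omega
    exact ⟨f T (i + 1), hTR T hTP _ (hfT T hTP _ hi'), hf T hTP i hi',
      by rw [hρf T hTP i hi, hρf T hTP _ hi']⟩
  · intro s hs hne
    obtain ⟨T, hTP, i, hi, rfl⟩ := hcases s hs
    rw [hρf T hTP i hi] at hne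
    obtain ⟨j, rfl⟩ := Nat.exists_eq_succ_of_ne_zero fun h : i = 0 => hne (by rw [h])
    have hj : j < n := by omega
    exact ⟨f T j, hTR T hTP _ (hfT T hTP _ hj), hf T hTP j hi,
      by rw [hρf T hTP j hj, hρf T hTP _ hi]⟩
  · intro s hs t ht hlev h
    obtain ⟨T, hTP, i, hi, rfl⟩ := hcases s hs
    obtain ⟨T', hTP', j, hj, rfl⟩ := hcases t ht
    rw [hρf T hTP i hi, hρf T' hTP' j hj] at h
    obtain rfl := hroot T hTP T' hTP' h
    rw [hlevel T hTP i hi, hlevel T hTP j hj] at hlev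
    rw [show i = j by omega]
  · have h1 : (R.filter fun s => ρ s = s) = P.image fun T => f T 0 := by
      ext s
      rw [Finset.mem_filter, Finset.mem_image]
      constructor
      · rintro ⟨hs, hs'⟩
        obtain ⟨T, hTP, i, hi, rfl⟩ := hcases s hs
        exact ⟨T, hTP, (hρf T hTP i hi).symm.trans hs'⟩
      · rintro ⟨T, hTP, rfl⟩
        exact ⟨hTR T hTP _ (hfT T hTP 0 hn), hρf T hTP 0 hn⟩
    have h2 : ∀ T ∈ P, T.card = n := fun T hTP => by
      rw [hT T hTP, Finset.card_image_of_injOn, Finset.card_range]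
      intro i hi j hj h
      exact hinj T hTP i (by simpa using hi) j (by simpa using hj) h
    rw [h1, Finset.card_image_of_injOn fun T hTP T' hTP' h => hroot T hTP T' hTP' h, ← hcover,
      Finset.card_biUnion fun T hTP T' hTP' hne => hdisj hTP hTP' hne, mul_comm]
    exact Finset.sum_const_nat h2
  · have hfib : ∀ T ∈ P, (R.filter fun t => ρ t = f T 0) = T := fun T hTP => by
      ext t
      rw [Finset.mem_filter]
      constructor
      · rintro ⟨ht, h⟩
        obtain ⟨T', hTP', i, hi, rfl⟩ := hcases t ht
        rw [hρf T' hTP' i hi] at h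
        obtain rfl := hroot T' hTP' T hTP h
        exact hfT T' hTP' i hi
      · exact fun ht => ⟨hTR T hTP t ht, hρ T hTP t ht⟩
    ext T
    rw [Finset.mem_image]
    constructor
    · intro hTP
      refine ⟨f T 0, hTR T hTP _ (hfT T hTP 0 hn), ?_⟩
      rw [hρf T hTP 0 hn, hfib T hTP]
    · rintro ⟨s, hs, rfl⟩
      obtain ⟨T, hTP, i, hi, rfl⟩ := hcases s hs
      rw [hρf T hTP i hi, hfib T hTP]
      exact hTP

lemma tilingCount_le_pow {n : ℕ} (hn : 0 < n) (R : Finset (ℤ × ℤ)) :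
    TilingCount n R ≤ n ^ (R.card / n) := by
  have hex : ∀ P, ∃ ρ, IsTiling n R P →
      IsRootLabeling n R ρ ∧ P = R.image fun s => R.filter fun t => ρ t = ρ s := fun P => by
    by_cases hP : IsTiling n R P
    · obtain ⟨ρ, h⟩ := hP.exists_isRootLabeling hn
      exact ⟨ρ, fun _ => h⟩
    · exact ⟨0, fun h => absurd h hP⟩
  choose ρ hρ using hex
  have hfin : {P | IsTiling n R P}.Finite := by
    refine (Finset.finite_toSet R.powerset.powerset).subset fun P hP => ?_
    rw [Finset.mem_coe, Finset.mem_powerset]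
    intro T hT
    rw [Finset.mem_powerset, ← hP.2.2]
    exact Finset.subset_biUnion_of_mem id hT
  have hinj : Set.InjOn ρ hfin.toFinset := by
    intro P hP Q hQ h
    rw [Finset.mem_coe, Set.Finite.mem_toFinset] at hP hQ
    rw [(hρ P hP).2, (hρ Q hQ).2, h]
  rw [TilingCount, Set.ncard_eq_toFinset_card _ hfin, ← Finset.card_image_of_injOn hinj]
  refine card_rootLabelings_le hn _ (Finset.forall_mem_image.2 fun P hP => ?_)
  exact (hρ P (hfin.mem_toFinset.1 hP)).1

theorem tilingCount_le_pow_and_entropy_le_log (n : ℕ) (hn : 2 ≤ n) (R : Finset (ℤ × ℤ)) :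
    TilingCount n R ≤ n ^ (R.card / n) ∧
    (R.Nonempty →
      Real.logb 2 (TilingCount n R) / ((R.card : ℝ) / n) ≤ Real.logb 2 n) := by
  have hle := tilingCount_le_pow (n := n) (by omega) R
  refine ⟨hle, fun hR => ?_⟩
  have hn0 : (0 : ℝ) < n := by exact_mod_cast (by omega : 0 < n)
  have hlog : 0 ≤ Real.logb 2 n :=
    Real.logb_nonneg one_lt_two (by exact_mod_cast (by omega : 1 ≤ n))
  have hR0 : (0 : ℝ) < R.card := by exact_mod_cast hR.card_pos
  rw [div_le_iff₀ (by positivity)]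
  rcases Nat.eq_zero_or_pos (TilingCount n R) with h0 | h0
  · rw [h0, Nat.cast_zero, Real.logb_zero]
    positivity
  · calc Real.logb 2 (TilingCount n R) ≤ Real.logb 2 ((n : ℝ) ^ (R.card / n)) :=
          Real.logb_le_logb_of_le one_lt_two (by exact_mod_cast h0) (by exact_mod_cast hle)
      _ = (R.card / n : ℕ) * Real.logb 2 n := Real.logb_pow ..
      _ ≤ (R.card : ℝ) / n * Real.logb 2 n := by
        gcongr
        exact Nat.cast_div_le
      _ = _ := mul_comm _ _
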